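/- Let 0 < p ≤ q with p ≤ 1 and 0 < r ≤ s with r ≤ 1. If f : S_{p,q} → S_{r,s} is a surjective α-Hölder map, then α ≤ (p + q + r + s − pr + qs) / ((2 + s − r)(p + q)). -/

import Mathlib

open Set Metric MeasureTheory

noncomputable def spiral (p q : ℝ) : Set ℂ :=
  {z : ℂ | ∃ t : ℝ, 1 < t ∧
    z = (t ^ (-p) * Real.cos t : ℝ) + (t ^ (-q) * Real.sin t : ℝ) * Complex.I}

/-- `f` is `α`-Hölder on the set `A`. -/
def HolderOnSet (f : ℂ → ℂ) (α : ℝ) (A : Set ℂ) : Prop :=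
  ∃ c : ℝ, 0 < c ∧ ∀ x ∈ A, ∀ y ∈ A, dist (f x) (f y) ≤ c * dist x y ^ α

/-- The point with parameter `t` on the elliptical polynomial spiral. -/
noncomputable def spiralPoint (p q t : ℝ) : ℂ :=
  ⟨t ^ (-p) * Real.cos t, t ^ (-q) * Real.sin t⟩

lemma mem_spiral_iff {p q : ℝ} {z : ℂ} :
    z ∈ spiral p q ↔ ∃ t : ℝ, 1 < t ∧ z = spiralPoint p q t := by
  simp only [spiral, mem_ofPred_eq, spiralPoint, Complex.mk_eq_add_mul_I]

lemma spiralPoint_mem {p q t : ℝ} (ht : 1 < t) : spiralPoint p q t ∈ spiral p q :=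
  mem_spiral_iff.2 ⟨t, ht, rfl⟩

/-- A real Hölder function on a subset extends to the whole space with the same constant. -/
lemma exists_holder_extension_real {X : Type*} [PseudoMetricSpace X] {A : Set X} {g : X → ℝ}
    {α c : ℝ} (hα₀ : 0 < α) (hα₁ : α ≤ 1) (hc : 0 ≤ c)
    (hg : ∀ x ∈ A, ∀ y ∈ A, dist (g x) (g y) ≤ c * dist x y ^ α) :
    ∃ G : X → ℝ, EqOn g G A ∧ ∀ x y, dist (G x) (G y) ≤ c * dist x y ^ α := by
  lift c to NNReal using hc
  let e : X ≃ Snowflaking X α hα₀ hα₁ := Snowflaking.toSnowflaking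
  have h : LipschitzOnWith c (g ∘ e.symm) (e '' A) := by
    refine LipschitzOnWith.of_dist_le_mul ?_
    rintro _ ⟨x, hx, rfl⟩ _ ⟨y, hy, rfl⟩
    simpa [e] using hg x hx y hy
  obtain ⟨G, hG, hGe⟩ := h.extend_real
  refine ⟨G ∘ e, fun x hx => ?_, fun x y => ?_⟩
  · simpa using hGe (mem_image_of_mem e hx)
  · simpa [e] using hG.dist_le_mul (e x) (e y)

lemma exists_holder_extension {X : Type*} [PseudoMetricSpace X] {A : Set X} {f : X → ℂ}
    {α c : ℝ} (hα₀ : 0 < α) (hα₁ : α ≤ 1) (hc : 0 ≤ c)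
    (hf : ∀ x ∈ A, ∀ y ∈ A, dist (f x) (f y) ≤ c * dist x y ^ α) :
    ∃ F : X → ℂ, EqOn f F A ∧ ∀ x y, dist (F x) (F y) ≤ 2 * c * dist x y ^ α := by
  obtain ⟨G, hGe, hG⟩ := exists_holder_extension_real (g := fun x => (f x).re) hα₀ hα₁ hc
    (fun x hx y hy => by
      refine le_trans ?_ (hf x hx y hy)
      rw [Real.dist_eq, dist_eq_norm, ← Complex.sub_re]
      exact Complex.abs_re_le_norm _)
  obtain ⟨H, hHe, hH⟩ := exists_holder_extension_real (g := fun x => (f x).im) hα₀ hα₁ hc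
    (fun x hx y hy => by
      refine le_trans ?_ (hf x hx y hy)
      rw [Real.dist_eq, dist_eq_norm, ← Complex.sub_im]
      exact Complex.abs_im_le_norm _)
  refine ⟨fun x => ⟨G x, H x⟩, fun x hx => Complex.ext (hGe hx) (hHe hx), fun x y => ?_⟩
  have h1 := hG x y
  have h2 := hH x y
  have h3 := Complex.norm_le_abs_re_add_abs_im ((⟨G x, H x⟩ : ℂ) - ⟨G y, H y⟩)
  simp only [Complex.sub_re, Complex.sub_im] at h3
  rw [Real.dist_eq] at h1 h2
  rw [dist_eq_norm]
  linarith

/-- A continuous nonvanishing complex function on a compact interval has a continuous argument. -/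
lemma exists_continuous_arg {a b : ℝ} (hab : a ≤ b) {G : ℝ → ℂ} (hG : ContinuousOn G (Icc a b))
    (hG₀ : ∀ x ∈ Icc a b, G x ≠ 0) :
    ∃ θ : ℝ → ℝ, Continuous θ ∧ ∀ x ∈ Icc a b,
      (G x).re = ‖G x‖ * Real.cos (θ x) ∧ (G x).im = ‖G x‖ * Real.sin (θ x) := by
  let g : C(ℝ, ℂ) := ⟨IccExtend hab ((Icc a b).domRestrict G),
    (continuousOn_iff_continuous_domRestrict.1 hG).Icc_extend'⟩
  have hg : ∀ x, g x ∈ ({0}ᶜ : Set ℂ) := fun x => hG₀ _ (projIcc a b hab x).2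
  obtain ⟨L, ⟨-, hL⟩, -⟩ := Complex.isCoveringMapOn_exp.existsUnique_continuousMap_lifts g
    (a₀ := a) (Complex.exp_log (hg a)) hg
  refine ⟨fun x => (L x).im, by fun_prop, fun x hx => ?_⟩
  have h : Complex.exp (L x) = G x := by
    have := congrFun hL x
    simpa [g, IccExtend_of_mem hab _ hx] using this
  rw [← h, Complex.norm_exp, Complex.exp_re, Complex.exp_im]
  exact ⟨rfl, rfl⟩

lemma strictMonoOn_sq_mul_rpow {r s : ℝ} (hr : 0 < r) (hs : 0 < s) {z : ℂ} (hz : z ≠ 0) :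
    StrictMonoOn (fun u : ℝ => z.re ^ 2 * u ^ (2 * r) + z.im ^ 2 * u ^ (2 * s)) (Ioi 0) := by
  intro u hu v hv huv
  have h1 : u ^ (2 * r) < v ^ (2 * r) := Real.rpow_lt_rpow (le_of_lt hu) huv (by positivity)
  have h2 : u ^ (2 * s) < v ^ (2 * s) := Real.rpow_lt_rpow (le_of_lt hu) huv (by positivity)
  have h3 : 0 < z.re ^ 2 + z.im ^ 2 := by
    by_contra! h
    have h4 : z.re ^ 2 = 0 := by nlinarith [sq_nonneg z.re, sq_nonneg z.im]
    have h5 : z.im ^ 2 = 0 := by nlinarith [sq_nonneg z.re, sq_nonneg z.im]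
    exact hz (Complex.ext (by simpa using h4) (by simpa using h5))
  rcases (sq_nonneg z.re).eq_or_lt with h | h
  · have : 0 < z.im ^ 2 := by linarith
    simp only [← h]
    nlinarith
  · have := sq_nonneg z.im
    simp only
    nlinarith

lemma spiralPoint_level (r s : ℝ) {u : ℝ} (hu : 0 < u) :
    (spiralPoint r s u).re ^ 2 * u ^ (2 * r) + (spiralPoint r s u).im ^ 2 * u ^ (2 * s) = 1 := by
  have h1 : ∀ w : ℝ, (u ^ (-w)) ^ 2 * u ^ (2 * w) = 1 := fun w => by
    rw [← Real.rpow_natCast, ← Real.rpow_mul hu.le, ← Real.rpow_add hu]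
    norm_num
    rw [show -(w * 2) + 2 * w = 0 by ring, Real.rpow_zero]
  simp only [spiralPoint]
  calc _ = ((u ^ (-r)) ^ 2 * u ^ (2 * r)) * Real.cos u ^ 2
        + ((u ^ (-s)) ^ 2 * u ^ (2 * s)) * Real.sin u ^ 2 := by ring
    _ = 1 := by rw [h1, h1]; linarith [Real.sin_sq_add_cos_sq u]

lemma spiralPoint_ne_zero (r s : ℝ) {u : ℝ} (hu : 0 < u) : spiralPoint r s u ≠ 0 := by
  intro h
  have := spiralPoint_level r s hu
  simp [h] at this

lemma continuousOn_spiralPoint (p q : ℝ) : ContinuousOn (spiralPoint p q) (Ioi 1) := by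
  have h : ∀ w : ℝ, ContinuousOn (fun t : ℝ => t ^ (-w)) (Ioi 1) := fun w =>
    ContinuousOn.rpow_const continuousOn_id fun t ht => .inl (by
      have : (1 : ℝ) < t := ht
      exact (zero_lt_one.trans this).ne')
  have h2 : spiralPoint p q = fun t => ((t ^ (-p) * Real.cos t : ℝ) : ℂ)
      + ((t ^ (-q) * Real.sin t : ℝ) : ℂ) * Complex.I := by
    ext t; simp only [spiralPoint, Complex.mk_eq_add_mul_I]
  rw [h2]
  refine ContinuousOn.add ?_ (ContinuousOn.mul ?_ continuousOn_const)
  · exact Complex.continuous_ofReal.comp_continuousOn ((h p).mul Real.continuous_cos.continuousOn)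
  · exact Complex.continuous_ofReal.comp_continuousOn ((h q).mul Real.continuous_sin.continuousOn)

/-- A continuous curve in a spiral has a continuous parameter. -/
lemma continuousOn_param {r s : ℝ} (hr : 0 < r) (hs : 0 < s) {γ : ℝ → ℂ} {φ : ℝ → ℝ} {A : Set ℝ}
    (hγ : ContinuousOn γ A) (hφ : ∀ t ∈ A, 1 < φ t ∧ γ t = spiralPoint r s (φ t)) :
    ContinuousOn φ A := by
  intro t ht
  obtain ⟨h1, h2⟩ := hφ t ht
  have hH : ∀ u : ℝ, ContinuousWithinAt
      (fun τ => (γ τ).re ^ 2 * u ^ (2 * r) + (γ τ).im ^ 2 * u ^ (2 * s)) A t := by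
    intro u
    have := hγ t ht
    have hre : ContinuousWithinAt (fun τ => (γ τ).re) A t :=
      Complex.continuous_re.continuousAt.comp_continuousWithinAt this
    have him : ContinuousWithinAt (fun τ => (γ τ).im) A t :=
      Complex.continuous_im.continuousAt.comp_continuousWithinAt this
    exact ((hre.pow 2).mul_const _).add ((him.pow 2).mul_const _)
  have hmono : ∀ τ ∈ A, StrictMonoOn
      (fun u : ℝ => (γ τ).re ^ 2 * u ^ (2 * r) + (γ τ).im ^ 2 * u ^ (2 * s)) (Ioi 0) := by
    intro τ hτ
    obtain ⟨h3, h4⟩ := hφ τ hτ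
    exact strictMonoOn_sq_mul_rpow hr hs (h4 ▸ spiralPoint_ne_zero r s (by linarith))
  have hlev : ∀ τ ∈ A, (γ τ).re ^ 2 * (φ τ) ^ (2 * r) + (γ τ).im ^ 2 * (φ τ) ^ (2 * s) = 1 := by
    intro τ hτ
    obtain ⟨h3, h4⟩ := hφ τ hτ
    rw [h4]
    exact spiralPoint_level r s (by linarith)
  refine tendsto_order.2 ⟨fun u hu => ?_, fun u hu => ?_⟩
  · by_cases hu0 : 0 < u
    · have h5 := hmono t ht hu0 (show φ t ∈ Ioi 0 from by simp; linarith) hu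
      simp only [hlev t ht] at h5
      filter_upwards [(hH u).eventually (gt_mem_nhds h5), self_mem_nhdsWithin] with τ h6 hτ
      by_contra! h7
      have h8 := (hmono τ hτ).monotoneOn
        (show φ τ ∈ Ioi 0 from by have := (hφ τ hτ).1; simp; linarith) hu0 h7
      simp only [hlev τ hτ] at h8
      linarith
    · filter_upwards [self_mem_nhdsWithin] with τ hτ
      have := (hφ τ hτ).1
      linarith
  · have hu0 : 0 < u := by linarith
    have h5 := hmono t ht (show φ t ∈ Ioi 0 from by simp; linarith) hu0 hu
    simp only [hlev t ht] at h5
    filter_upwards [(hH u).eventually (lt_mem_nhds h5), self_mem_nhdsWithin] with τ h6 hτ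
    by_contra! h7
    have h8 := (hmono τ hτ).monotoneOn hu0
      (show φ τ ∈ Ioi 0 from by have := (hφ τ hτ).1; simp; linarith) h7
    simp only [hlev τ hτ] at h8
    linarith

lemma exists_crossing_of_le {φ : ℝ → ℝ} {a b A B : ℝ} (hab : a ≤ b) (hAB : A ≤ B)
    (hφ : ContinuousOn φ (Icc a b)) (ha : φ a ≤ A) (hb : B ≤ φ b) :
    ∃ t₁ t₂, a ≤ t₁ ∧ t₁ ≤ t₂ ∧ t₂ ≤ b ∧ φ t₁ = A ∧ φ t₂ = B ∧
      ∀ t ∈ Icc t₁ t₂, φ t ∈ Icc A B := by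
  have hne : (Icc a b ∩ φ ⁻¹' {B}).Nonempty := by
    obtain ⟨t, ht, h⟩ := intermediate_value_Icc hab hφ ⟨ha.trans hAB, hb⟩
    exact ⟨t, ht, h⟩
  obtain ⟨t₂, ⟨ht₂, hφ₂⟩, hmin⟩ := (isCompact_Icc.of_isClosed_subset
    (hφ.preimage_isClosed_of_isClosed isClosed_Icc isClosed_singleton)
    inter_subset_left).exists_isLeast hne
  have hφ' : ContinuousOn φ (Icc a t₂) := hφ.mono (Icc_subset_Icc_right ht₂.2)
  simp only [mem_preimage, mem_singleton_iff] at hφ₂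
  have hne' : (Icc a t₂ ∩ φ ⁻¹' {A}).Nonempty := by
    obtain ⟨t, ht, h⟩ := intermediate_value_Icc ht₂.1 hφ' ⟨ha, hφ₂ ▸ hAB⟩
    exact ⟨t, ht, h⟩
  obtain ⟨t₁, ⟨ht₁, hφ₁⟩, hmax⟩ := (isCompact_Icc.of_isClosed_subset
    (hφ'.preimage_isClosed_of_isClosed isClosed_Icc isClosed_singleton)
    inter_subset_left).exists_isGreatest hne'
  simp only [mem_preimage, mem_singleton_iff] at hφ₁
  refine ⟨t₁, t₂, ht₁.1, ht₁.2, ht₂.2, hφ₁, hφ₂, fun t ht => ⟨?_, ?_⟩⟩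
  · by_contra! h
    obtain ⟨τ, hτ, h'⟩ := intermediate_value_Icc ht.2
      (hφ'.mono (Icc_subset_Icc_left (ht₁.1.trans ht.1))) ⟨h.le, hφ₂ ▸ hAB⟩
    have h1 := hmax ⟨⟨(ht₁.1.trans ht.1).trans hτ.1, hτ.2⟩, h'⟩
    have : t = τ := le_antisymm hτ.1 (h1.trans ht.1)
    rw [this, h'] at h
    exact lt_irrefl _ h
  · by_contra! h
    obtain ⟨τ, hτ, h'⟩ := intermediate_value_Icc (ht₁.1.trans ht.1)
      (hφ'.mono (Icc_subset_Icc_right ht.2)) ⟨ha.trans hAB, h.le⟩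
    have h1 := hmin ⟨⟨hτ.1, hτ.2.trans (ht.2.trans ht₂.2)⟩, h'⟩
    have : t = τ := le_antisymm (ht.2.trans h1) hτ.2
    rw [this, h'] at h
    exact lt_irrefl _ h

/-- A continuous function that passes `A` and `B` crosses `[A, B]` on some subinterval. -/
lemma exists_crossing {φ : ℝ → ℝ} {a b A B : ℝ} (hAB : A ≤ B)
    (hφ : ContinuousOn φ (uIcc a b)) (ha : φ a ≤ A) (hb : B ≤ φ b) :
    ∃ t₁ t₂, uIcc t₁ t₂ ⊆ uIcc a b ∧ φ t₁ = A ∧ φ t₂ = B ∧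
      ∀ t ∈ uIcc t₁ t₂, φ t ∈ Icc A B := by
  rcases le_total a b with hab | hab
  · rw [uIcc_of_le hab] at hφ ⊢
    obtain ⟨t₁, t₂, h1, h2, h3, h4, h5, h6⟩ := exists_crossing_of_le hab hAB hφ ha hb
    refine ⟨t₁, t₂, ?_, h4, h5, ?_⟩ <;> rw [uIcc_of_le h2]
    exacts [Icc_subset_Icc h1 h3, h6]
  · rw [uIcc_of_ge hab] at hφ ⊢
    obtain ⟨t₁, t₂, h1, h2, h3, h4, h5, h6⟩ := exists_crossing_of_le (φ := fun t => φ (-t))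
      (neg_le_neg hab) hAB (hφ.comp continuousOn_neg fun t ht => by
        simp only [mem_Icc] at ht ⊢; constructor <;> linarith)
      (by simpa using ha) (by simpa using hb)
    refine ⟨-t₁, -t₂, ?_, h4, h5, ?_⟩ <;> rw [uIcc_of_ge (neg_le_neg h2)]
    · exact Icc_subset_Icc (by linarith) (by linarith)
    · intro t ht
      simpa using h6 (-t) ⟨by linarith [ht.2], by linarith [ht.1]⟩

lemma hasDerivAt_spiralPoint (p q : ℝ) {t : ℝ} (ht : 0 < t) :
    HasDerivAt (spiralPoint p q)
      (((-p * t ^ (-p - 1) * Real.cos t + t ^ (-p) * -Real.sin t : ℝ) : ℂ) +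
        ((-q * t ^ (-q - 1) * Real.sin t + t ^ (-q) * Real.cos t : ℝ) : ℂ) * Complex.I) t := by
  have h2 : spiralPoint p q = fun t => ((t ^ (-p) * Real.cos t : ℝ) : ℂ)
      + ((t ^ (-q) * Real.sin t : ℝ) : ℂ) * Complex.I := by
    ext t; simp only [spiralPoint, Complex.mk_eq_add_mul_I]
  rw [h2]
  have h := fun w => Real.hasDerivAt_rpow_const (x := t) (p := -w) (.inl ht.ne')
  exact ((h p).mul (Real.hasDerivAt_cos t)).ofReal_comp.add
    (((h q).mul (Real.hasDerivAt_sin t)).ofReal_comp.mul_const _)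

lemma dist_spiralPoint_le {p q b : ℝ} (hp : 0 < p) (hpq : p ≤ q) (hb : 0 < b) (hpb : 1 - p ≤ b)
    {t t' : ℝ} (ht : 1 ≤ t) (htt' : t ≤ t') :
    dist (spiralPoint p q t') (spiralPoint p q t) ≤ (2 + p + q) / b * (t' ^ b - t ^ b) := by
  rw [dist_eq_norm]
  refine image_norm_le_of_norm_deriv_right_le_deriv_boundary'
    (f := fun u => spiralPoint p q u - spiralPoint p q t)
    (B := fun u => (2 + p + q) / b * (u ^ b - t ^ b))
    (B' := fun u => (2 + p + q) / b * (b * u ^ (b - 1))) (a := t) (b := t') ?_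
    (fun u hu => ((hasDerivAt_spiralPoint p q
      (by linarith [hu.1] : (0 : ℝ) < u)).sub_const _).hasDerivWithinAt) (by simp) ?_
    (fun u hu => (((Real.hasDerivAt_rpow_const
      (.inl (by linarith [hu.1] : (0 : ℝ) < u).ne')).sub_const _).const_mul _).hasDerivWithinAt)
    ?_ ⟨htt', le_rfl⟩
  · exact fun u hu => ((hasDerivAt_spiralPoint p q
      (by linarith [hu.1] : (0 : ℝ) < u)).sub_const _).continuousAt.continuousWithinAt
  · exact fun u hu => (((Real.hasDerivAt_rpow_const
      (.inl (by linarith [hu.1] : (0 : ℝ) < u).ne')).sub_const _).const_mul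
        _).continuousAt.continuousWithinAt
  · intro u hu
    have hu1 : 1 ≤ u := ht.trans hu.1
    have hC := Real.abs_cos_le_one u
    have hS := Real.abs_sin_le_one u
    have key : ∀ w, p ≤ w → u ^ (-w) ≤ u ^ (b - 1) ∧ u ^ (-w - 1) ≤ u ^ (b - 1) := fun w hw =>
      ⟨Real.rpow_le_rpow_of_exponent_le hu1 (by linarith),
        Real.rpow_le_rpow_of_exponent_le hu1 (by linarith)⟩
    have hpos : ∀ w : ℝ, 0 < u ^ w := fun w => Real.rpow_pos_of_pos (by linarith) w
    have hm : ∀ A w σ : ℝ, 0 ≤ A → A ≤ w → |σ| ≤ 1 → |A * σ| ≤ w := fun A w σ h1 h2 h3 => by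
      rw [abs_mul, abs_of_nonneg h1]
      nlinarith
    have bd : ∀ w σ τ : ℝ, p ≤ w → |σ| ≤ 1 → |τ| ≤ 1 →
        |-w * u ^ (-w - 1) * σ + u ^ (-w) * τ| ≤ (w + 1) * u ^ (b - 1) := by
      intro w σ τ hw hσ hτ
      obtain ⟨k1, k2⟩ := key w hw
      have e1 := hm _ _ _ (hpos (-w - 1)).le k2 hσ
      have e2 := hm _ _ _ (hpos (-w)).le k1 hτ
      calc _ ≤ |-w * u ^ (-w - 1) * σ| + |u ^ (-w) * τ| := abs_add_le _ _
        _ = w * |u ^ (-w - 1) * σ| + |u ^ (-w) * τ| := by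
          rw [mul_assoc, abs_mul, abs_neg, abs_of_nonneg (by linarith : 0 ≤ w)]
        _ ≤ w * u ^ (b - 1) + u ^ (b - 1) := by
          gcongr
          linarith
        _ = _ := by ring
    have b1 := bd p (Real.cos u) (-Real.sin u) le_rfl hC (by rwa [abs_neg])
    have b2 := bd q (Real.sin u) (Real.cos u) hpq hS hC
    refine (norm_add_le _ _).trans ?_
    rw [norm_mul, Complex.norm_I, mul_one, Complex.norm_real, Complex.norm_real,
      Real.norm_eq_abs, Real.norm_eq_abs]
    refine (add_le_add b1 b2).trans (le_of_eq ?_)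
    field_simp
    ring

/-- On each half-turn through the upper half plane the spiral attains every small abscissa. -/
lemma exists_upper_point {r x V : ℝ} {k : ℕ} (hr : 0 ≤ r) (hV : 0 < V)
    (hk : V ≤ 2 * Real.pi * k) (hk' : 2 * Real.pi * k + Real.pi ≤ 2 * V) (hx : 0 ≤ x)
    (hxV : x ≤ 1 / 2 * (2 * V) ^ (-r)) :
    ∃ u ∈ Icc (2 * Real.pi * k) (2 * Real.pi * k + Real.pi),
      u ^ (-r) * Real.cos u = x ∧ 1 / 2 ≤ Real.sin u := by
  have hpi := Real.pi_pos
  have hcos : Real.cos (2 * Real.pi * k) = 1 := by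
    rw [mul_comm]; exact Real.cos_nat_mul_two_pi k
  have hle : ∀ u, V ≤ u → u ≤ 2 * V → (2 * V) ^ (-r) ≤ u ^ (-r) := fun u h1 h2 =>
    Real.rpow_le_rpow_of_nonpos (by linarith) h2 (by linarith)
  have hpos : ∀ w y : ℝ, 0 < y → 0 < y ^ w := fun w y hy => Real.rpow_pos_of_pos hy w
  have hcont : ContinuousOn (fun u : ℝ => u ^ (-r) * Real.cos u)
      (Icc (2 * Real.pi * k) (2 * Real.pi * k + Real.pi)) := by
    refine ContinuousOn.mul (ContinuousOn.rpow_const continuousOn_id fun u hu => .inl ?_)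
      Real.continuous_cos.continuousOn
    exact (lt_of_lt_of_le hV (hk.trans hu.1)).ne'
  obtain ⟨u, hu, hux⟩ := intermediate_value_Icc' (by linarith) hcont (show x ∈ Icc _ _ from by
    have h1 := hle _ hk (by linarith)
    have h2 := hpos (-r) (2 * Real.pi * k + Real.pi) (by linarith)
    have h3 := hpos (-r) (2 * V) (by linarith)
    rw [Real.cos_add_pi, hcos]
    constructor <;> linarith)
  refine ⟨u, hu, hux, ?_⟩
  have h1 := hle u (by linarith [hu.1]) (by linarith [hu.2])
  have h2 := hpos (-r) (2 * V) (by linarith)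
  have hs0 : 0 ≤ Real.sin u := by
    rw [← Real.sin_sub_nat_mul_two_pi u k]
    exact Real.sin_nonneg_of_nonneg_of_le_pi (by linarith [hu.1]) (by linarith [hu.2])
  simp only at hux
  have hc0 : 0 ≤ Real.cos u := by
    by_contra! h
    nlinarith
  have hc1 : Real.cos u ≤ 1 / 2 := by
    by_contra! h
    nlinarith
  nlinarith [Real.sin_sq_add_cos_sq u]

lemma rpow_neg_sub_rpow_neg_ge {s u u' W : ℝ} (hs : 0 < s) (hu : 0 < u) (huu' : u < u')
    (hW : u' ≤ W) : s * W ^ (-s - 1) * (u' - u) ≤ u ^ (-s) - u' ^ (-s) := by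
  obtain ⟨v, hv, h⟩ := exists_hasDerivAt_eq_slope (fun y : ℝ => y ^ (-s))
    (fun y => -s * y ^ (-s - 1)) huu'
    (ContinuousOn.rpow_const continuousOn_id fun y hy => .inl (lt_of_lt_of_le hu hy.1).ne')
    (fun y hy => Real.hasDerivAt_rpow_const (.inl (hu.trans hy.1).ne'))
  rw [eq_div_iff (by linarith)] at h
  have h1 : W ^ (-s - 1) ≤ v ^ (-s - 1) :=
    Real.rpow_le_rpow_of_nonpos (hu.trans hv.1) (hv.2.le.trans hW) (by linarith)
  have h2 : s * W ^ (-s - 1) * (u' - u) ≤ s * v ^ (-s - 1) * (u' - u) := by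
    gcongr
  linarith

/-- Two points of the spiral with the same abscissa on different turns are well separated. -/
lemma im_spiralPoint_sub_ge {r s u u' W : ℝ} (hr : 0 ≤ r) (hs : 0 < s) (hu : 0 < u)
    (huu' : u + 1 ≤ u') (hW : u' ≤ W)
    (h : u ^ (-r) * Real.cos u = u' ^ (-r) * Real.cos u') (h0 : 0 ≤ u ^ (-r) * Real.cos u)
    (hsin : 1 / 2 ≤ Real.sin u) (hsin' : 1 / 2 ≤ Real.sin u') :
    s / 2 * W ^ (-s - 1) ≤ u ^ (-s) * Real.sin u - u' ^ (-s) * Real.sin u' := by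
  have hu' : 0 < u' := by linarith
  have h1 := rpow_neg_sub_rpow_neg_ge hs hu (by linarith : u < u') hW
  have hWp : 0 < W ^ (-s - 1) := Real.rpow_pos_of_pos (by linarith) _
  have p1 : 0 < u ^ (-r) := Real.rpow_pos_of_pos hu _
  have p2 : 0 < u' ^ (-r) := Real.rpow_pos_of_pos hu' _
  have p3 : 0 < u' ^ (-s) := Real.rpow_pos_of_pos hu' _
  have hle : u' ^ (-r) ≤ u ^ (-r) :=
    Real.rpow_le_rpow_of_nonpos hu (by linarith) (by linarith)
  have c0 : 0 ≤ Real.cos u := by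
    by_contra! hc
    nlinarith
  have c0' : 0 ≤ Real.cos u' := by
    by_contra! hc
    nlinarith
  have c1 : Real.cos u ≤ Real.cos u' := by
    by_contra! hc
    nlinarith
  have s1 : Real.sin u' ≤ Real.sin u := by
    by_contra! hc
    nlinarith [Real.sin_sq_add_cos_sq u, Real.sin_sq_add_cos_sq u']
  have h2 : s * W ^ (-s - 1) * 1 ≤ s * W ^ (-s - 1) * (u' - u) := by
    gcongr
    linarith
  have h3 : 0 < s * W ^ (-s - 1) := by positivity
  nlinarith [mul_le_mul_of_nonneg_left s1 p3.le]

/-- Counting: if the turns of the second spiral with parameters in `[V, 2 * V]` are images of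
the first spiral up to parameter `T`, the latter must be long enough. -/
lemma card_le_of_cover {p q r s α b c σ δ V T : ℝ} {φ : ℝ → ℝ} {K₀ K J : ℕ}
    (hp : 0 < p) (hpq : p ≤ q) (hr : 0 < r) (hs : 0 < s) (hα : 0 < α) (hb : 0 < b)
    (hpb : 1 - p ≤ b) (hc : 0 < c) (hV : 0 < V) (hT : 0 ≤ T) (hσ : σ = s / 2 * (2 * V) ^ (-s - 1))
    (hδ : 0 < δ) (hδσ : c * ((2 + p + q) / b * δ) ^ α < σ)
    (hH : ∀ t t', 1 < t → 1 < t' → dist (spiralPoint r s (φ t)) (spiralPoint r s (φ t')) ≤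
      c * dist (spiralPoint p q t) (spiralPoint p q t') ^ α)
    (hK₀ : V ≤ 2 * Real.pi * K₀) (hK : 2 * Real.pi * (K₀ + K) ≤ 2 * V)
    (hJ : J * σ ≤ 1 / 2 * (2 * V) ^ (-r))
    (hcov : ∀ u ∈ Icc V (2 * V), ∃ t, 1 < t ∧ t ≤ T ∧ φ t = u) :
    (K : ℝ) * J ≤ T ^ b / δ + 1 := by
  have hpi := Real.pi_gt_three
  have hσ0 : 0 < σ := by
    have : 0 < (2 * V) ^ (-s - 1) := Real.rpow_pos_of_pos (by linarith) _
    rw [hσ]; positivity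
  have hex : ∀ m : Fin K × Fin J, ∃ u ∈ Icc (2 * Real.pi * ((K₀ + m.1 : ℕ) : ℝ))
      (2 * Real.pi * ((K₀ + m.1 : ℕ) : ℝ) + Real.pi), u ^ (-r) * Real.cos u = m.2 * σ ∧
      1 / 2 ≤ Real.sin u ∧ V ≤ u ∧ u ≤ 2 * V := by
    rintro ⟨i, j⟩
    have hi : (i : ℝ) + 1 ≤ K := by exact_mod_cast i.2
    have hj : (j : ℝ) ≤ J := by exact_mod_cast j.2.le
    have h1 : V ≤ 2 * Real.pi * ((K₀ + i : ℕ) : ℝ) := by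
      push_cast
      have : (0 : ℝ) ≤ (i : ℕ) := Nat.cast_nonneg _
      nlinarith
    have h2 : 2 * Real.pi * ((K₀ + i : ℕ) : ℝ) + Real.pi ≤ 2 * V := by
      push_cast
      nlinarith
    obtain ⟨u, hu, hu1, hu2⟩ := exists_upper_point (x := j * σ) hr.le hV h1 h2 (by positivity)
      ((mul_le_mul_of_nonneg_right hj hσ0.le).trans hJ)
    exact ⟨u, hu, hu1, hu2, h1.trans hu.1, hu.2.trans h2⟩
  choose u hu hux hus huV huV' using hex
  choose t ht htT htu using fun m => hcov (u m) ⟨huV m, huV' m⟩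
  have hsep : ∀ m m', m ≠ m' → σ ≤ dist (spiralPoint r s (u m)) (spiralPoint r s (u m')) := by
    intro m m' hne
    rw [dist_eq_norm]
    by_cases hj : m.2 = m'.2
    · have hi : m.1 ≠ m'.1 := fun h => hne (Prod.ext h hj)
      have aux : ∀ n n' : Fin K × Fin J, n.2 = n'.2 → n.1 < n'.1 →
          σ ≤ (u n) ^ (-s) * Real.sin (u n) - (u n') ^ (-s) * Real.sin (u n') := by
        intro n n' hj hlt
        rw [hσ]
        refine im_spiralPoint_sub_ge hr.le hs (hV.trans_le (huV n)) ?_ (huV' n') ?_ ?_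
          (hus n) (hus n')
        · have h1 := (hu n).2
          have h2 := (hu n').1
          have h3 : (n.1 : ℝ) + 1 ≤ (n'.1 : ℕ) := by exact_mod_cast hlt
          push_cast at h1 h2
          nlinarith
        · rw [hux, hux, hj]
        · rw [hux]; positivity
      refine le_trans ?_ (Complex.abs_im_le_norm _)
      rw [Complex.sub_im]
      simp only [spiralPoint]
      rcases lt_or_gt_of_ne hi with h | h
      · exact (aux m m' hj h).trans (le_abs_self _)
      · rw [abs_sub_comm]
        exact (aux m' m hj.symm h).trans (le_abs_self _)
    · refine le_trans ?_ (Complex.abs_re_le_norm _)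
      rw [Complex.sub_re]
      simp only [spiralPoint]
      rw [hux, hux, ← sub_mul, abs_mul, abs_of_pos hσ0]
      have h1 : (1 : ℝ) ≤ |((m.2 : ℕ) : ℝ) - (m'.2 : ℕ)| := by
        have : ((m.2 : ℕ) : ℤ) - (m'.2 : ℕ) ≠ 0 := by
          intro h
          exact hj (Fin.ext (by omega))
        exact_mod_cast Int.one_le_abs this
      nlinarith
  have hTb : 0 ≤ T ^ b / δ := by positivity
  have hinj : Function.Injective (fun m : Fin K × Fin J => ⌊(t m) ^ b / δ⌋₊) := by
    intro m m' hmm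
    by_contra hne
    have hclose : ∀ n n', ⌊(t n) ^ b / δ⌋₊ = ⌊(t n') ^ b / δ⌋₊ → t n ≤ t n' →
        dist (spiralPoint p q (t n')) (spiralPoint p q (t n)) ≤ (2 + p + q) / b * δ := by
      intro n n' he hle
      refine (dist_spiralPoint_le hp hpq hb hpb (ht n).le hle).trans ?_
      have h0 : 0 ≤ (t n) ^ b / δ := by
        have := ht n
        positivity
      have h1 := Nat.lt_floor_add_one ((t n') ^ b / δ)
      have h2 := Nat.floor_le h0
      rw [← he] at h1
      have h3 : (t n') ^ b / δ - (t n) ^ b / δ < 1 := by linarith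
      rw [← sub_div, div_lt_one hδ] at h3
      have h4 : 0 ≤ (2 + p + q) / b := div_nonneg (by linarith) hb.le
      gcongr
    have h1 : dist (spiralPoint p q (t m)) (spiralPoint p q (t m')) ≤ (2 + p + q) / b * δ := by
      rcases le_total (t m) (t m') with h | h
      · rw [dist_comm]; exact hclose m m' hmm h
      · exact hclose m' m hmm.symm h
    have h2 := hH (t m) (t m') (ht m) (ht m')
    rw [htu, htu] at h2
    have h3 := hsep m m' hne
    have h4 : c * dist (spiralPoint p q (t m)) (spiralPoint p q (t m')) ^ α ≤
        c * ((2 + p + q) / b * δ) ^ α := by gcongr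
    linarith
  have hcard := Finset.card_le_card_of_injOn (s := Finset.univ)
    (t := Finset.range (⌊T ^ b / δ⌋₊ + 1)) (fun m : Fin K × Fin J => ⌊(t m) ^ b / δ⌋₊)
    (fun m _ => by
      simp only [Finset.coe_range, mem_Iio, Nat.lt_succ_iff]
      refine Nat.floor_le_floor ?_
      have := ht m
      have := htT m
      gcongr) hinj.injOn
  rw [Finset.card_univ, Fintype.card_prod, Fintype.card_fin, Fintype.card_fin,
    Finset.card_range] at hcard
  have h1 : ((K * J : ℕ) : ℝ) ≤ (⌊T ^ b / δ⌋₊ + 1 : ℕ) := by exact_mod_cast hcard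
  push_cast at h1
  linarith [Nat.floor_le hTb]

lemma eventually_mul_rpow_add_one_lt {e₁ e₂ C D : ℝ} (he₁ : 0 ≤ e₁) (he : e₁ < e₂) (hD : 0 < D) :
    ∀ᶠ W : ℝ in Filter.atTop, C * W ^ e₁ + 1 < D * W ^ e₂ := by
  have h := tendsto_rpow_atTop (show 0 < e₂ - e₁ by linarith)
  filter_upwards [h.eventually_gt_atTop ((C + 1) / D), Filter.eventually_ge_atTop 1] with W h1 h2
  have h3 : 1 ≤ W ^ e₁ := Real.one_le_rpow h2 he₁
  have h4 : W ^ e₂ = W ^ e₁ * W ^ (e₂ - e₁) := by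
    rw [← Real.rpow_add (by linarith)]; ring_nf
  rw [div_lt_iff₀ hD] at h1
  rw [h4]
  nlinarith

/-- A short initial part of the first spiral cannot be mapped onto the turns of the second one
with parameters in `[V, 2 * V]`. -/
lemma eventually_exists_uncovered {p q r s α a b c : ℝ} {φ : ℝ → ℝ}
    (hp : 0 < p) (hpq : p ≤ q) (hr : 0 < r) (hr1 : r ≤ 1) (hs : 0 < s) (hα : 0 < α) (ha : 0 ≤ a)
    (hb : 0 < b) (hpb : 1 - p ≤ b) (hc : 0 < c) (hexp : a * b + (1 + s) / α < 2 + s - r)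
    (hH : ∀ t t', 1 < t → 1 < t' → dist (spiralPoint r s (φ t)) (spiralPoint r s (φ t')) ≤
      c * dist (spiralPoint p q t) (spiralPoint p q t') ^ α) :
    ∀ᶠ V : ℝ in Filter.atTop, ∃ u ∈ Icc V (2 * V), ∀ t, 1 < t → t ≤ V ^ a → φ t ≠ u := by
  set C := (2 + p + q) / b * (4 * c / s) ^ (1 / α) with hCdef
  have hC0 : 0 < (2 + p + q) / b := div_pos (by linarith) hb
  have hdouble : Filter.Tendsto (fun V : ℝ => 2 * V) Filter.atTop Filter.atTop :=
    Filter.tendsto_id.const_mul_atTop two_pos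
  have h1 := hdouble.eventually (eventually_mul_rpow_add_one_lt (C := C)
    (by positivity : 0 ≤ a * b + (1 + s) / α) hexp
    (by positivity : 0 < 1 / (160 * s)))
  have h2 := hdouble.eventually ((tendsto_rpow_atTop
    (show 0 < 1 + s - r by linarith)).eventually_ge_atTop (2 * s))
  filter_upwards [h1, h2, Filter.eventually_ge_atTop 40] with V h1 h2 hV
  by_contra! hcov
  have hpi := Real.pi_gt_three
  have hpi' := Real.pi_lt_d2
  have hV0 : 0 < V := by linarith
  set W := 2 * V with hW
  have hW0 : 0 < W := by linarith
  obtain ⟨σ, hσ⟩ : ∃ σ, σ = s / 2 * W ^ (-s - 1) := ⟨_, rfl⟩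
  have hσ0 : 0 < σ := by rw [hσ]; positivity
  obtain ⟨δ, hδ⟩ : ∃ δ, δ = (σ / (2 * c)) ^ (1 / α) / ((2 + p + q) / b) := ⟨_, rfl⟩
  have hδ0 : 0 < δ := by rw [hδ]; positivity
  have hδσ : c * ((2 + p + q) / b * δ) ^ α < σ := by
    rw [hδ, mul_div_cancel₀ _ hC0.ne', ← Real.rpow_mul (by positivity), one_div,
      inv_mul_cancel₀ hα.ne', Real.rpow_one]
    field_simp
    linarith
  set y := 1 / 2 * W ^ (-r) / σ with hy
  have hy1 : y = 1 / s * W ^ (1 + s - r) := by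
    have h3 : W ^ (-r) = W ^ (1 + s - r) * W ^ (-s - 1) := by
      rw [← Real.rpow_add hW0]; ring_nf
    have h4 : 0 < W ^ (-s - 1) := by positivity
    rw [hy, hσ, h3]
    field_simp
  have hy2 : 2 ≤ y := by
    rw [hy1]
    field_simp
    linarith
  have hy0 : 0 ≤ y := by linarith
  have hK₀ := Nat.le_ceil (V / (2 * Real.pi))
  have hK₀' := Nat.ceil_lt_add_one (by positivity : 0 ≤ V / (2 * Real.pi))
  have hK := Nat.floor_le (by positivity : 0 ≤ V / 20)
  have hK' := Nat.lt_floor_add_one (V / 20)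
  have hJ := Nat.floor_le hy0
  have hJ' := Nat.lt_floor_add_one y
  have hcard := card_le_of_cover (K₀ := ⌈V / (2 * Real.pi)⌉₊) (K := ⌊V / 20⌋₊) (J := ⌊y⌋₊)
    hp hpq hr hs hα hb hpb hc hV0 (by positivity : 0 ≤ V ^ a) hσ hδ0 hδσ hH
    (by rwa [div_le_iff₀' (by positivity)] at hK₀)
    (by
      have h3 : 2 * Real.pi * (V / (2 * Real.pi)) = V := by field_simp
      nlinarith)
    (by
      have := mul_le_mul_of_nonneg_right hJ hσ0.le
      rwa [hy, div_mul_cancel₀ _ hσ0.ne'] at this)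
    (fun u hu => hcov u hu)
  have hlow : 1 / (160 * s) * W ^ (2 + s - r) ≤ (⌊V / 20⌋₊ : ℝ) * ⌊y⌋₊ := by
    have h3 : V / 40 ≤ ⌊V / 20⌋₊ := by linarith
    have h4 : y / 2 ≤ ⌊y⌋₊ := by linarith
    calc 1 / (160 * s) * W ^ (2 + s - r) = V / 40 * (y / 2) := by
          rw [hy1, show 2 + s - r = 1 + (1 + s - r) by ring, Real.rpow_add hW0, Real.rpow_one, hW]
          field_simp
          norm_num
      _ ≤ _ := by gcongr
  have hup : (V ^ a) ^ b / δ ≤ C * W ^ (a * b + (1 + s) / α) := by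
    have h3 : (V ^ a) ^ b ≤ W ^ (a * b) := by
      rw [← Real.rpow_mul hV0.le]
      exact Real.rpow_le_rpow hV0.le (by linarith) (by positivity)
    have h4 : δ⁻¹ = C * W ^ ((1 + s) / α) := by
      rw [hδ, inv_div, div_eq_mul_inv, ← Real.inv_rpow (by positivity), inv_div, hCdef, mul_assoc,
        div_eq_mul_one_div (1 + s) α, Real.rpow_mul hW0.le, ← Real.mul_rpow (by positivity)
        (by positivity), hσ, show -s - 1 = -(1 + s) by ring, Real.rpow_neg hW0.le]
      congr 2
      field_simp
      norm_num
    rw [div_eq_mul_inv, h4, Real.rpow_add hW0]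
    calc _ ≤ W ^ (a * b) * (C * W ^ ((1 + s) / α)) := by gcongr
      _ = _ := by ring
  linarith

/-- A continuous function that varies by at least `d` hits every progression of step `d`. -/
lemma exists_eq_add_int_mul {h : ℝ → ℝ} {x y d : ℝ} (hd : 0 < d) (hh : ContinuousOn h (uIcc x y))
    (hxy : d ≤ |h x - h y|) (e : ℝ) : ∃ z ∈ uIcc x y, ∃ k : ℤ, h z = e + k * d := by
  set v := min (h x) (h y) with hv
  have h1 := Int.le_ceil ((v - e) / d)
  have h2 := Int.ceil_lt_add_one ((v - e) / d)
  set k := ⌈(v - e) / d⌉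
  rw [div_le_iff₀ hd] at h1
  have h3 : (k : ℝ) * d < v - e + d := by
    have : (k : ℝ) * d < ((v - e) / d + 1) * d := mul_lt_mul_of_pos_right h2 hd
    rwa [add_mul, div_mul_cancel₀ _ hd.ne', one_mul] at this
  have h4 : max (h x) (h y) - v = |h x - h y| := max_sub_min_eq_abs' _ _
  obtain ⟨z, hz, hzk⟩ := intermediate_value_uIcc hh
    (show e + k * d ∈ uIcc (h x) (h y) from ⟨by show v ≤ _; linarith, by
      show _ ≤ max (h x) (h y); linarith⟩)
  exact ⟨z, hz, k, hzk⟩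

lemma abs_sub_lt_pi_of_cos_ne_zero {h : ℝ → ℝ} {x y : ℝ} (hh : ContinuousOn h (uIcc x y))
    (hcos : ∀ z ∈ uIcc x y, Real.cos (h z) ≠ 0) : |h x - h y| < Real.pi := by
  by_contra! hxy
  obtain ⟨z, hz, k, hk⟩ := exists_eq_add_int_mul Real.pi_pos hh hxy (Real.pi / 2)
  exact hcos z hz (Real.cos_eq_zero_iff.2 ⟨k, by rw [hk]; ring⟩)

/-- A function varying by at least a full turn meets both directions of the real axis. -/
lemma exists_cos_eq_one_and_neg_one {h : ℝ → ℝ} {x y : ℝ} (hh : ContinuousOn h (uIcc x y))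
    (hxy : 2 * Real.pi ≤ |h x - h y|) :
    ∃ z ∈ uIcc x y, ∃ z' ∈ uIcc x y, Real.cos (h z) = 1 ∧ Real.cos (h z') = -1 := by
  obtain ⟨z, hz, k, hk⟩ := exists_eq_add_int_mul Real.two_pi_pos hh hxy 0
  obtain ⟨z', hz', k', hk'⟩ := exists_eq_add_int_mul Real.two_pi_pos hh hxy Real.pi
  refine ⟨z, hz, z', hz', ?_, ?_⟩
  · rw [hk, zero_add, Real.cos_int_mul_two_pi]
  · rw [hk', Real.cos_add_int_mul_two_pi, Real.cos_pi]

lemma abs_sub_le_of_local_oscillation {θ : ℝ → ℝ} {a b ℓ M : ℝ} (hℓ : 0 < ℓ) (hM : 0 ≤ M)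
    (hloc : ∀ x ∈ Icc a b, ∀ y ∈ Icc a b, |x - y| ≤ ℓ → |θ x - θ y| ≤ M)
    {x y : ℝ} (hx : x ∈ Icc a b) (hy : y ∈ Icc a b) :
    |θ x - θ y| ≤ M * (|x - y| / ℓ + 1) := by
  have key : ∀ n : ℕ, ∀ x ∈ Icc a b, ∀ y ∈ Icc a b, |x - y| ≤ n * ℓ → |θ x - θ y| ≤ M * n := by
    intro n
    induction n with
    | zero =>
      intro x _ y _ h
      have : x = y := by simpa [sub_eq_zero] using h
      simp [this]
    | succ n ih =>
      intro x hx y hy h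
      have hn : (0 : ℝ) < n + 1 := by positivity
      push_cast at h ⊢
      obtain ⟨w, hw⟩ : ∃ w, w = (1 : ℝ) / (n + 1) := ⟨_, rfl⟩
      have hw1 : w * (n + 1) = 1 := by rw [hw]; field_simp
      have hw0 : 0 < w := by rw [hw]; positivity
      have hw2 : w ≤ 1 := by
        have : (0 : ℝ) ≤ n := Nat.cast_nonneg n
        nlinarith
      have hz : (1 - w) * x + w * y ∈ Icc a b :=
        convex_Icc a b hx hy (by linarith) hw0.le (by ring)
      have e1 : |x - ((1 - w) * x + w * y)| ≤ ℓ := by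
        rw [show x - ((1 - w) * x + w * y) = w * (x - y) by ring, abs_mul, abs_of_pos hw0]
        calc w * |x - y| ≤ w * ((n + 1) * ℓ) := by gcongr
          _ = ℓ := by rw [← mul_assoc, hw1, one_mul]
      have e2 : |((1 - w) * x + w * y) - y| ≤ n * ℓ := by
        rw [show ((1 - w) * x + w * y) - y = (1 - w) * (x - y) by ring, abs_mul,
          abs_of_nonneg (by linarith : 0 ≤ 1 - w)]
        calc (1 - w) * |x - y| ≤ (1 - w) * ((n + 1) * ℓ) := by
              have : 0 ≤ 1 - w := by linarith
              gcongr
          _ = n * ℓ := by linear_combination (-ℓ) * hw1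
      have h1 := hloc x hx _ hz e1
      have h2 := ih _ hz y hy e2
      have h3 := abs_sub_le (θ x) (θ ((1 - w) * x + w * y)) (θ y)
      linarith
  have h1 := Nat.le_ceil (|x - y| / ℓ)
  have h2 := Nat.ceil_lt_add_one (by positivity : 0 ≤ |x - y| / ℓ)
  refine (key ⌈|x - y| / ℓ⌉₊ x hx y hy ?_).trans (by gcongr)
  rwa [div_le_iff₀ hℓ] at h1

lemma abs_re_spiralPoint_le {p T t : ℝ} (q : ℝ) (hp : 0 ≤ p) (hT : 0 < T) (ht : T ≤ t) :
    |(spiralPoint p q t).re| ≤ T ^ (-p) := by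
  have h1 : t ^ (-p) ≤ T ^ (-p) := Real.rpow_le_rpow_of_nonpos hT ht (by linarith)
  have h2 : 0 < t ^ (-p) := Real.rpow_pos_of_pos (by linarith) _
  simp only [spiralPoint]
  rw [abs_mul, abs_of_pos h2]
  nlinarith [Real.abs_cos_le_one t]

lemma abs_im_spiralPoint_le {q T t : ℝ} (p : ℝ) (hq : 0 ≤ q) (hT : 0 < T) (ht : T ≤ t) :
    |(spiralPoint p q t).im| ≤ T ^ (-q) := by
  have h1 : t ^ (-q) ≤ T ^ (-q) := Real.rpow_le_rpow_of_nonpos hT ht (by linarith)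
  have h2 : 0 < t ^ (-q) := Real.rpow_pos_of_pos (by linarith) _
  simp only [spiralPoint]
  rw [abs_mul, abs_of_pos h2]
  nlinarith [Real.abs_sin_le_one t]

lemma continuous_of_dist_le {F : ℂ → ℂ} {C α : ℝ} (hα : 0 < α)
    (hF : ∀ x y, dist (F x) (F y) ≤ C * dist x y ^ α) : Continuous F := by
  refine continuous_iff_continuousAt.2 fun x => ?_
  rw [ContinuousAt, tendsto_iff_dist_tendsto_zero]
  have h1 : Filter.Tendsto (fun y => C * dist y x ^ α) (nhds x) (nhds 0) := by
    have : Continuous (fun y => C * dist y x ^ α) :=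
      continuous_const.mul ((continuous_id.dist continuous_const).rpow_const
        fun _ => .inr hα.le)
    simpa [Real.zero_rpow hα.ne'] using this.tendsto x
  exact squeeze_zero (fun _ => dist_nonneg) (fun y => hF y x) h1

/-- If the image of the minor axis of the tail `t > T` is much shorter than the minor axis of the
turns `[2 * U, 3 * U]`, then a Hölder map of the tail over these turns factors, up to a small
error, through the major axis, and this limits the number of turns. -/
lemma turning_bound {p q r s α C U T ℓ t₁ t₂ : ℝ} {φ : ℝ → ℝ} {F : ℂ → ℂ}
    (hp : 0 ≤ p) (hq : 0 ≤ q) (hr : 0 ≤ r) (hrs : r ≤ s) (hα : 0 < α) (hC : 0 < C)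
    (hU : 1 ≤ U) (hT : 1 ≤ T) (hF : ∀ x y, dist (F x) (F y) ≤ C * dist x y ^ α)
    (ht : ∀ t ∈ uIcc t₁ t₂, T < t) (hφ₁ : φ t₁ = 2 * U) (hφ₂ : φ t₂ = 3 * U)
    (hφ : ∀ t ∈ uIcc t₁ t₂, φ t ∈ Icc (2 * U) (3 * U)) (hφc : ContinuousOn φ (uIcc t₁ t₂))
    (hFφ : ∀ t ∈ uIcc t₁ t₂, F (spiralPoint p q t) = spiralPoint r s (φ t))
    (hsmall : U ^ s * (C * (T ^ (-q)) ^ α) ≤ 1 / 4 * (1 / 3) ^ s)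
    (hℓ : 0 < ℓ) (hℓ' : U ^ r * (C * ℓ ^ α) < (1 / 3) ^ s) :
    U - Real.pi ≤ 2 * Real.pi * (2 / ℓ + 1) := by
  have hU0 : 0 < U := by linarith
  have hT0 : 0 < T := by linarith
  set m : ℝ := (1 / 3) ^ s with hm
  have hm0 : 0 < m := by positivity
  set ξ : ℝ → ℝ := fun t => (spiralPoint p q t).re with hξ
  have hξc : ContinuousOn ξ (uIcc t₁ t₂) :=
    Complex.continuous_re.comp_continuousOn
      ((continuousOn_spiralPoint p q).mono fun t h => hT.trans_lt (ht t h))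
  set lo := sInf (ξ '' uIcc t₁ t₂)
  set hi := sSup (ξ '' uIcc t₁ t₂)
  have himg : ξ '' uIcc t₁ t₂ = Icc lo hi := hξc.image_uIcc_eq_Icc
  have hmem : ∀ t ∈ uIcc t₁ t₂, ξ t ∈ Icc lo hi := fun t h => himg ▸ mem_image_of_mem ξ h
  have hlohi : lo ≤ hi := by
    have := hmem t₁ left_mem_uIcc
    exact this.1.trans this.2
  have hξ1 : ∀ t ∈ uIcc t₁ t₂, |ξ t| ≤ 1 := fun t h => by
    have := abs_re_spiralPoint_le (p := p) q hp one_pos (hT.trans (ht t h).le)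
    rwa [Real.one_rpow] at this
  have hFc : Continuous F := continuous_of_dist_le hα hF
  set G : ℝ → ℂ := fun x => ((U ^ r * (F x).re : ℝ) : ℂ) + ((U ^ s * (F x).im : ℝ) : ℂ) * Complex.I
    with hG
  have hGre : ∀ x, (G x).re = U ^ r * (F x).re := fun x => by
    rw [hG, Complex.add_re, Complex.ofReal_re, Complex.re_ofReal_mul, Complex.I_re]; ring
  have hGim : ∀ x, (G x).im = U ^ s * (F x).im := fun x => by
    rw [hG, Complex.add_im, Complex.ofReal_im, Complex.im_ofReal_mul, Complex.I_im]; ring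
  have hGc : Continuous G := by fun_prop
  have hrs' : U ^ r ≤ U ^ s := Real.rpow_le_rpow_of_exponent_le hU hrs
  have hUr : 0 < U ^ r := by positivity
  have hUs : 0 < U ^ s := by positivity
  have hdir : ∀ t ∈ uIcc t₁ t₂,
      m / 2 ≤ (G (ξ t)).re * Real.cos (φ t) + (G (ξ t)).im * Real.sin (φ t) := by
    intro t h
    obtain ⟨h1, h2⟩ := hφ t h
    have hφ0 : 0 < φ t := by linarith
    set η := C * (T ^ (-q)) ^ α
    have hd : ‖F (ξ t) - spiralPoint r s (φ t)‖ ≤ η := by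
      rw [← hFφ t h, ← dist_eq_norm]
      refine (hF _ _).trans ?_
      have : dist ((ξ t : ℝ) : ℂ) (spiralPoint p q t) ≤ T ^ (-q) := by
        have e : ((ξ t : ℝ) : ℂ) - spiralPoint p q t
            = ((-(spiralPoint p q t).im : ℝ) : ℂ) * Complex.I := by
          apply Complex.ext <;> simp [hξ]
        rw [dist_eq_norm, e, norm_mul, Complex.norm_I, mul_one, Complex.norm_real,
          Real.norm_eq_abs, abs_neg]
        exact abs_im_spiralPoint_le p hq hT0 (ht t h).le
      exact mul_le_mul_of_nonneg_left (Real.rpow_le_rpow dist_nonneg this hα.le) hC.le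
    have hre := (Complex.abs_re_le_norm _).trans hd
    have him := (Complex.abs_im_le_norm _).trans hd
    rw [Complex.sub_re] at hre
    rw [Complex.sub_im] at him
    have hpow : ∀ w, 0 ≤ w → w ≤ s → m ≤ U ^ w * (φ t) ^ (-w) := by
      intro w hw0 hw
      rw [Real.rpow_neg hφ0.le, ← div_eq_mul_inv, ← Real.div_rpow hU0.le hφ0.le]
      have h3 : 1 / 3 ≤ U / φ t := by
        rw [div_le_div_iff₀ (by norm_num) hφ0]; linarith
      calc m ≤ (1 / 3 : ℝ) ^ w :=
            Real.rpow_le_rpow_of_exponent_ge (by norm_num) (by norm_num) hw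
        _ ≤ _ := Real.rpow_le_rpow (by norm_num) h3 hw0
    have p1 := hpow r hr hrs
    have p2 := hpow s (hr.trans hrs) le_rfl
    have hmul : ∀ w A σ : ℝ, 0 < w → w ≤ U ^ s → |A| ≤ η → |σ| ≤ 1 → -(m / 4) ≤ w * A * σ := by
      intro w A σ hw hwU hA hσ
      have : |w * A * σ| ≤ m / 4 := by
        rw [abs_mul, abs_mul, abs_of_pos hw]
        calc w * |A| * |σ| ≤ U ^ s * η * 1 := by gcongr
          _ ≤ m / 4 := by linarith
      exact (abs_le.1 this).1
    have q1 := hmul _ _ (Real.cos (φ t)) hUr hrs' hre (Real.abs_cos_le_one _)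
    have q2 := hmul _ _ (Real.sin (φ t)) hUs le_rfl him (Real.abs_sin_le_one _)
    rw [hGre, hGim]
    simp only [spiralPoint] at q1 q2
    have s1 := mul_le_mul_of_nonneg_right p1 (sq_nonneg (Real.cos (φ t)))
    have s2 := mul_le_mul_of_nonneg_right p2 (sq_nonneg (Real.sin (φ t)))
    have s3 := Real.sin_sq_add_cos_sq (φ t)
    have s4 : m * Real.sin (φ t) ^ 2 + m * Real.cos (φ t) ^ 2 = m := by rw [← mul_add, s3, mul_one]
    linarith
  have hG0 : ∀ x ∈ Icc lo hi, G x ≠ 0 := by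
    intro x hx h0
    rw [← himg] at hx
    obtain ⟨t, h, rfl⟩ := hx
    have := hdir t h
    rw [h0] at this
    simp at this
    linarith
  obtain ⟨θ, hθc, hθ⟩ := exists_continuous_arg hlohi hGc.continuousOn hG0
  have hcosdir : ∀ t ∈ uIcc t₁ t₂, m / 2 ≤ ‖G (ξ t)‖ * Real.cos (θ (ξ t) - φ t) := by
    intro t h
    obtain ⟨e1, e2⟩ := hθ _ (hmem t h)
    have := hdir t h
    rw [e1, e2] at this
    rw [Real.cos_sub]
    linarith
  have hnorm : ∀ x ∈ Icc lo hi, m / 2 ≤ ‖G x‖ := by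
    intro x hx
    rw [← himg] at hx
    obtain ⟨t, h, rfl⟩ := hx
    exact (hcosdir t h).trans (mul_le_of_le_one_right (norm_nonneg _) (Real.cos_le_one _))
  have hturn : |(θ (ξ t₁) - φ t₁) - (θ (ξ t₂) - φ t₂)| < Real.pi := by
    refine abs_sub_lt_pi_of_cos_ne_zero (h := fun t => θ (ξ t) - φ t)
      ((hθc.comp_continuousOn hξc).sub hφc) fun t h h0 => ?_
    have := hcosdir t h
    rw [h0, mul_zero] at this
    linarith
  have hosc := abs_sub_le_of_local_oscillation (θ := θ) (a := lo) (b := hi) hℓ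
    Real.two_pi_pos.le (fun x hx y hy hxy => by
      by_contra! hlt
      obtain ⟨z, hz, z', hz', c1, c2⟩ :=
        exists_cos_eq_one_and_neg_one hθc.continuousOn hlt.le
      have hsub : uIcc x y ⊆ Icc lo hi := uIcc_subset_Icc hx hy
      have e1 := (hθ z (hsub hz)).1
      have e2 := (hθ z' (hsub hz')).1
      have n1 := hnorm z (hsub hz)
      have n2 := hnorm z' (hsub hz')
      rw [c1, hGre] at e1
      rw [c2, hGre] at e2
      have hzz : |z - z'| ≤ ℓ := (abs_sub_comm z z').trans_le
        ((abs_sub_le_of_uIcc_subset_uIcc (uIcc_subset_uIcc hz hz')).trans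
          ((abs_sub_comm y x).trans_le hxy))
      have h1 : (F z).re - (F z').re ≤ C * ℓ ^ α := by
        rw [← Complex.sub_re]
        refine ((le_abs_self _).trans (Complex.abs_re_le_norm _)).trans ?_
        rw [← dist_eq_norm]
        refine (hF _ _).trans ?_
        rw [Complex.dist_of_im_eq (by simp), Complex.ofReal_re, Complex.ofReal_re, Real.dist_eq]
        gcongr
      have h2 := mul_le_mul_of_nonneg_left h1 hUr.le
      linarith) (hmem t₁ left_mem_uIcc) (hmem t₂ right_mem_uIcc)
  have hlen : |ξ t₁ - ξ t₂| ≤ 2 := by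
    have h1 := abs_le.1 (hξ1 t₁ left_mem_uIcc)
    have h2 := abs_le.1 (hξ1 t₂ right_mem_uIcc)
    rw [abs_le]
    constructor <;> linarith
  have hfin : |θ (ξ t₁) - θ (ξ t₂)| ≤ 2 * Real.pi * (2 / ℓ + 1) := hosc.trans (by gcongr)
  rw [hφ₁, hφ₂] at hturn
  have h1 := (abs_lt.1 hturn).2
  have h2 := (abs_le.1 hfin).1
  linarith

lemma spiralPoint_injOn {r s : ℝ} (hr : 0 < r) (hs : 0 < s) : InjOn (spiralPoint r s) (Ioi 0) := by
  intro u hu v hv h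
  refine (strictMonoOn_sq_mul_rpow hr hs (spiralPoint_ne_zero r s hu)).injOn hu hv ?_
  have h1 := spiralPoint_level r s hu
  have h2 := spiralPoint_level r s hv
  rw [← h] at h2
  exact h1.trans h2.symm

lemma eventually_mul_rpow_lt {C e ε : ℝ} (he : e < 0) (hε : 0 < ε) :
    ∀ᶠ W : ℝ in Filter.atTop, C * W ^ e < ε := by
  have h := (tendsto_rpow_neg_atTop (show 0 < -e by linarith)).const_mul C
  rw [neg_neg, mul_zero] at h
  exact h.eventually_lt_const hε

/-- Exponents for which the initial part `t ≤ V ^ a` of the first spiral is too short to cover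
the turns of the second one with parameters in `[V, 2 * V]`. -/
lemma exists_exponents {p q r s α : ℝ} (hp : 0 < p) (hq : 0 < q) (hp1 : p ≤ 1)
    (hr : 0 < r) (hs : 0 < s) (hα : 0 < α)
    (h : p + q + r + s - p * r + q * s < α * ((2 + s - r) * (p + q))) :
    ∃ a b : ℝ, 0 < a ∧ 0 < b ∧ 1 - p ≤ b ∧ a * b + (1 + s) / α < 2 + s - r ∧
      r + s < a * (α * (p + q)) := by
  have hpq : 0 < α * (p + q) := by positivity
  obtain ⟨a₀, ha₀⟩ : ∃ a₀, a₀ = (r + s) / (α * (p + q)) := ⟨_, rfl⟩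
  have ha₀' : a₀ * (α * (p + q)) = r + s := by rw [ha₀, div_mul_cancel₀ _ hpq.ne']
  have ha₀0 : 0 < a₀ := by rw [ha₀]; positivity
  have hlt : a₀ * (1 - p) + (1 + s) / α < 2 + s - r := by
    have e : a₀ * (1 - p) + (1 + s) / α =
        (p + q + r + s - p * r + q * s) / (α * (p + q)) := by
      rw [ha₀]; field_simp; ring
    rw [e, div_lt_iff₀ hpq]
    linarith
  have hc : Filter.Tendsto (fun ε : ℝ => (a₀ + ε) * (1 - p + ε) + (1 + s) / α)
      (nhdsWithin 0 (Ioi 0)) (nhds (a₀ * (1 - p) + (1 + s) / α)) := by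
    have : Continuous (fun ε : ℝ => (a₀ + ε) * (1 - p + ε) + (1 + s) / α) := by fun_prop
    simpa using (this.tendsto 0).mono_left nhdsWithin_le_nhds
  obtain ⟨ε, h1, h2⟩ := ((hc.eventually_lt_const hlt).and self_mem_nhdsWithin).exists
  have hε : 0 < ε := h2
  refine ⟨a₀ + ε, 1 - p + ε, by linarith, by linarith, by linarith, h1, ?_⟩
  rw [add_mul, ha₀']
  linarith [mul_pos hε hpq]

lemma lt_of_lt_mul {p q r s α : ℝ} (hp : 0 < p) (hq : 0 < q) (hp1 : p ≤ 1) (hr : 0 < r)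
    (hs : 0 < s) (hr1 : r ≤ 1)
    (h : p + q + r + s - p * r + q * s < α * ((2 + s - r) * (p + q))) : r < α := by
  by_contra! hle
  have h1 : α * ((2 + s - r) * (p + q)) ≤ r * ((2 + s - r) * (p + q)) :=
    mul_le_mul_of_nonneg_right hle (mul_nonneg (by linarith) (by linarith))
  have h2 : r * (2 + s - r) ≤ 1 + s := by nlinarith [sq_nonneg (1 - r)]
  have h3 := mul_le_mul_of_nonneg_right h2 (show 0 ≤ p + q by linarith)
  nlinarith

lemma major_axis_le_of_full_turn {φ : ℝ → ℝ} {p q r s α C U T t₁ t₂ : ℝ} {F : ℂ → ℂ}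
    (hp : 0 ≤ p) (hpq : p ≤ q) (hr : 0 ≤ r) (hα : 0 < α) (hC : 0 < C)
    (hU : 2 * Real.pi ≤ U) (hT : 1 ≤ T) (hF : ∀ x y, dist (F x) (F y) ≤ C * dist x y ^ α)
    (ht : ∀ t ∈ uIcc t₁ t₂, T < t) (hφ₁ : φ t₁ = 2 * U) (hφ₂ : φ t₂ = 3 * U)
    (hφ : ∀ t ∈ uIcc t₁ t₂, φ t ∈ Icc (2 * U) (3 * U)) (hφc : ContinuousOn φ (uIcc t₁ t₂))
    (hFφ : ∀ t ∈ uIcc t₁ t₂, F (spiralPoint p q t) = spiralPoint r s (φ t)) :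
    2 * (3 * U) ^ (-r) ≤ C * (4 * T ^ (-p)) ^ α := by
  have hpi := Real.pi_pos
  obtain ⟨t, h, t', h', c, c'⟩ := exists_cos_eq_one_and_neg_one hφc (by
    rw [hφ₁, hφ₂, show 2 * U - 3 * U = -U by ring, abs_neg]
    exact hU.trans (le_abs_self U))
  have hT0 : 0 < T := by linarith
  have hTq : T ^ (-q) ≤ T ^ (-p) := Real.rpow_le_rpow_of_exponent_le hT (by linarith)
  have hsize : ∀ t ∈ uIcc t₁ t₂, ‖spiralPoint p q t‖ ≤ 2 * T ^ (-p) := fun t h => by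
    have h1 := abs_re_spiralPoint_le q hp hT0 (ht t h).le
    have h2 := abs_im_spiralPoint_le p (hp.trans hpq) hT0 (ht t h).le
    have h3 := Complex.norm_le_abs_re_add_abs_im (spiralPoint p q t)
    linarith
  have hlow : ∀ t ∈ uIcc t₁ t₂, (3 * U) ^ (-r) ≤ φ t ^ (-r) := fun t h =>
    Real.rpow_le_rpow_of_nonpos (by linarith [(hφ t h).1]) (hφ t h).2 (by linarith)
  have hdist : dist (spiralPoint p q t) (spiralPoint p q t') ≤ 4 * T ^ (-p) := by
    rw [dist_eq_norm]
    linarith [norm_sub_le (spiralPoint p q t) (spiralPoint p q t'), hsize t h, hsize t' h']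
  have h1 := hF (spiralPoint p q t) (spiralPoint p q t')
  rw [hFφ t h, hFφ t' h', dist_eq_norm] at h1
  have h2 := (le_abs_self _).trans
    (Complex.abs_re_le_norm (spiralPoint r s (φ t) - spiralPoint r s (φ t')))
  rw [Complex.sub_re] at h2
  have e1 : (spiralPoint r s (φ t)).re = φ t ^ (-r) := by simp [spiralPoint, c]
  have e2 : (spiralPoint r s (φ t')).re = -φ t' ^ (-r) := by simp [spiralPoint, c']
  rw [e1, e2] at h2
  have h3 : C * dist (spiralPoint p q t) (spiralPoint p q t') ^ α ≤ C * (4 * T ^ (-p)) ^ α :=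
    mul_le_mul_of_nonneg_left (Real.rpow_le_rpow dist_nonneg hdist hα.le) hC.le
  linarith [hlow t h, hlow t' h']

/-- A Hölder map onto a spiral lifts to the parameters. -/
lemma exists_lift {p q r s : ℝ} {f F : ℂ → ℂ} (hr : 0 < r) (hs : 0 < s)
    (hsurj : f '' spiral p q = spiral r s) (hFf : EqOn F f (spiral p q)) (hF : Continuous F) :
    ∃ φ : ℝ → ℝ, (∀ t, 1 < t → 1 < φ t ∧ F (spiralPoint p q t) = spiralPoint r s (φ t)) ∧
      ContinuousOn φ (Ioi 1) ∧ ∀ u, 1 < u → ∃ t, 1 < t ∧ φ t = u := by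
  have hex : ∀ t, ∃ u, 1 < t → 1 < u ∧ F (spiralPoint p q t) = spiralPoint r s u := by
    intro t
    by_cases ht : 1 < t
    · have : f (spiralPoint p q t) ∈ spiral r s :=
        hsurj ▸ mem_image_of_mem f (spiralPoint_mem ht)
      obtain ⟨u, hu, h⟩ := mem_spiral_iff.1 this
      exact ⟨u, fun _ => ⟨hu, (hFf (spiralPoint_mem ht)).trans h⟩⟩
    · exact ⟨0, fun h => absurd h ht⟩
  choose φ hφ using hex
  refine ⟨φ, hφ, continuousOn_param hr hs
    (hF.comp_continuousOn (continuousOn_spiralPoint p q)) fun t ht => hφ t ht, fun u hu => ?_⟩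
  have : spiralPoint r s u ∈ f '' spiral p q := hsurj ▸ spiralPoint_mem hu
  obtain ⟨z, hz, hzu⟩ := this
  obtain ⟨t, ht, rfl⟩ := mem_spiral_iff.1 hz
  refine ⟨t, ht, spiralPoint_injOn hr hs (zero_lt_one.trans (hφ t ht).1) (zero_lt_one.trans hu) ?_⟩
  rw [← (hφ t ht).2, ← hzu]
  exact hFf hz

lemma eventually_exists_crossing {φ : ℝ → ℝ} {a : ℝ} (ha : 0 ≤ a)
    (hφc : ContinuousOn φ (Ioi 1)) (hφs : ∀ u, 1 < u → ∃ t, 1 < t ∧ φ t = u)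
    (h : ∀ᶠ V : ℝ in Filter.atTop, ∃ u ∈ Icc V (2 * V), ∀ t, 1 < t → t ≤ V ^ a → φ t ≠ u) :
    ∀ᶠ U : ℝ in Filter.atTop, ∃ t₁ t₂, (∀ t ∈ uIcc t₁ t₂, U ^ a < t) ∧ φ t₁ = 2 * U ∧
      φ t₂ = 3 * U ∧ ∀ t ∈ uIcc t₁ t₂, φ t ∈ Icc (2 * U) (3 * U) := by
  have h3 := (Filter.tendsto_id.const_mul_atTop (show (0 : ℝ) < 3 by norm_num)).eventually h
  filter_upwards [h, h3, Filter.eventually_gt_atTop 1] with U h h3 hU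
  simp only [id] at h3
  obtain ⟨u, ⟨hu1, hu2⟩, hu⟩ := h
  obtain ⟨v, ⟨hv1, hv2⟩, hv⟩ := h3
  obtain ⟨x, hx, rfl⟩ := hφs u (by linarith)
  obtain ⟨y, hy, rfl⟩ := hφs v (by linarith)
  have hx' : U ^ a < x := by
    by_contra! hle
    exact hu x hx hle rfl
  have hy' : U ^ a < y := by
    by_contra! hle
    exact hv y hy (hle.trans
      (Real.rpow_le_rpow (by linarith) (by linarith) ha)) rfl
  have hsub : uIcc x y ⊆ Ioi (U ^ a) := fun t ht => (lt_min hx' hy').trans_le ht.1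
  have h1 : 1 ≤ U ^ a := Real.one_le_rpow hU.le ha
  obtain ⟨t₁, t₂, hs, e1, e2, hI⟩ := exists_crossing (by linarith : 2 * U ≤ 3 * U)
    (hφc.mono (hsub.trans (Ioi_subset_Ioi h1))) hu2 hv1
  exact ⟨t₁, t₂, fun t ht => hsub (hs ht), e1, e2, hI⟩

theorem holder_exponent_bound_profile (p q r s α : ℝ) (f : ℂ → ℂ)
    (hp : 0 < p) (hpq : p ≤ q) (hp1 : p ≤ 1)
    (hr : 0 < r) (hrs : r ≤ s) (hr1 : r ≤ 1)
    (hα0 : 0 < α) (hα1 : α ≤ 1)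
    (hsurj : f '' spiral p q = spiral r s)
    (hf : HolderOnSet f α (spiral p q)) :
    α ≤ (p + q + r + s - p * r + q * s) / ((2 + s - r) * (p + q)) := by
  have hq : 0 < q := by linarith
  have hs : 0 < s := by linarith
  have hden : 0 < (2 + s - r) * (p + q) := mul_pos (by linarith) (by linarith)
  rw [le_div_iff₀ hden]
  by_contra! hlt
  have hrα := lt_of_lt_mul hp hq hp1 hr hs hr1 hlt
  obtain ⟨a, b, ha, hb, hpb, hab, hrsa⟩ := exists_exponents hp hq hp1 hr hs hα0 hlt
  obtain ⟨c, hc, hf⟩ := hf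
  obtain ⟨F, hFf, hF⟩ := exists_holder_extension hα0 hα1 hc.le hf
  obtain ⟨C, hCc⟩ : ∃ C, C = 2 * c := ⟨_, rfl⟩
  rw [← hCc] at hF
  have hC : 0 < C := by linarith
  obtain ⟨φ, hφ, hφc, hφs⟩ := exists_lift hr hs hsurj hFf.symm (continuous_of_dist_le hα0 hF)
  have hcross := eventually_exists_crossing ha.le hφc hφs
    (eventually_exists_uncovered hp hpq hr hr1 hs hα0 ha.le hb hpb hC hab fun t t' ht ht' => by
      rw [← (hφ t ht).2, ← (hφ t' ht').2]
      exact hF _ _)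
  have hmono : ∀ {U : ℝ}, 1 ≤ U → ∀ {t₁ t₂ : ℝ}, (∀ t ∈ uIcc t₁ t₂, U ^ a < t) →
      ∀ t ∈ uIcc t₁ t₂, 1 < t := fun hU _ _ h t ht =>
    (Real.one_le_rpow hU ha.le).trans_lt (h t ht)
  have hpow : ∀ {U : ℝ}, 0 < U → ∀ w v : ℝ, U ^ v * ((U ^ a) ^ (-w)) ^ α = U ^ (v - a * w * α) := by
    intro U hU w v
    rw [← Real.rpow_mul hU.le, ← Real.rpow_mul hU.le, ← Real.rpow_add hU]
    ring_nf
  have hapr : a * p * α ≤ r := by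
    by_contra! hrp
    obtain ⟨U, ⟨t₁, t₂, h1, h2, h3, h4⟩, hU, h5⟩ := (hcross.and
      ((Filter.eventually_ge_atTop (2 * Real.pi)).and (eventually_mul_rpow_lt
        (C := C * 4 ^ α) (e := r - a * p * α) (ε := 2 * 3 ^ (-r))
        (by linarith) (by positivity)))).exists
    have hU1 : 1 ≤ U := by linarith [Real.pi_gt_three]
    have hU0 : 0 < U := by linarith
    have h6 := major_axis_le_of_full_turn hp.le hpq hr.le hα0 hC hU (Real.one_le_rpow hU1 ha.le) hF
      h1 h2 h3 h4 (hφc.mono (hmono hU1 h1)) fun t ht => (hφ t (hmono hU1 h1 t ht)).2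
    rw [Real.mul_rpow (by norm_num) hU0.le, Real.mul_rpow (by norm_num) (by positivity)] at h6
    have h7 := mul_le_mul_of_nonneg_left h6 (show 0 ≤ U ^ r by positivity)
    have h8 : U ^ r * U ^ (-r) = 1 := by rw [← Real.rpow_add hU0, add_neg_cancel, Real.rpow_zero]
    have h9 : U ^ r * (2 * (3 ^ (-r) * U ^ (-r))) = 2 * 3 ^ (-r) := by
      linear_combination (2 * 3 ^ (-r)) * h8
    have h10 : U ^ r * (C * (4 ^ α * ((U ^ a) ^ (-p)) ^ α)) =
        C * 4 ^ α * U ^ (r - a * p * α) := by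
      rw [← hpow hU0]; ring
    linarith
  have hsq : s < a * q * α := by nlinarith
  obtain ⟨κ, hκ⟩ : ∃ κ, κ = ((1 / 3) ^ s / (2 * C)) ^ (1 / α) := ⟨_, rfl⟩
  have hκ0 : 0 < κ := by rw [hκ]; positivity
  have hκα : C * κ ^ α = (1 / 3) ^ s / 2 := by
    rw [hκ, ← Real.rpow_mul (by positivity), one_div_mul_cancel hα0.ne', Real.rpow_one]
    field_simp
  obtain ⟨U, ⟨t₁, t₂, h1, h2, h3, h4⟩, hU1, h5, h6⟩ := (hcross.and
    ((Filter.eventually_ge_atTop 1).and ((eventually_mul_rpow_lt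
      (C := C) (e := s - a * q * α) (ε := 1 / 4 * (1 / 3) ^ s)
      (by linarith) (by positivity)).and (eventually_mul_rpow_add_one_lt
      (C := 4 * Real.pi / κ + 3 * Real.pi) (e₁ := r / α) (e₂ := 1) (D := 1)
      (by positivity) (by rwa [div_lt_one hα0]) one_pos)))).exists
  have hU0 : 0 < U := by linarith
  have hℓα : U ^ r * (C * (κ * U ^ (-(r / α))) ^ α) = (1 / 3) ^ s / 2 := by
    rw [Real.mul_rpow hκ0.le (by positivity), ← Real.rpow_mul hU0.le, neg_mul,
      div_mul_cancel₀ _ hα0.ne', ← mul_assoc C, hκα, mul_left_comm, ← Real.rpow_add hU0,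
      add_neg_cancel, Real.rpow_zero, mul_one]
  have h7 := turning_bound hp.le hq.le hr.le hrs hα0 hC hU1 (Real.one_le_rpow hU1 ha.le) hF
    h1 h2 h3 h4 (hφc.mono (hmono hU1 h1)) (fun t ht => (hφ t (hmono hU1 h1 t ht)).2)
    (by rw [mul_left_comm, hpow hU0]; exact h5.le)
    (ℓ := κ * U ^ (-(r / α))) (by positivity)
    (by rw [hℓα]; linarith [show (0 : ℝ) < (1 / 3) ^ s by positivity])
  rw [Real.rpow_neg hU0.le] at h7
  rw [Real.rpow_one, one_mul] at h6
  have h8 : 1 ≤ U ^ (r / α) := Real.one_le_rpow hU1 (by positivity)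
  have h9 : 2 * Real.pi * (2 / (κ * (U ^ (r / α))⁻¹) + 1) =
      4 * Real.pi / κ * U ^ (r / α) + 2 * Real.pi := by
    field_simp
    ring
  rw [h9] at h7
  nlinarith [Real.pi_pos]
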